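/- Let f ∈ 𝒮(ℝ^d) and let ρ ∈ 𝒮(ℝ^d) satisfy ∫ ρ(x) dx = 1 and ∫ x^m ρ(x) dx = 0 for every multi-index m ≠ 0. Then the net (f ∗ ρ_ε − f)_{ε∈(0,1]} is negligible in the Schwartz sense: for all q, l ∈ ℕ and all m ∈ ℕ, μ_{q,l}(f ∗ ρ_ε − f) = O(ε^m) as ε→0, where (f ∗ ρ_ε)(y) = ∫_{ℝ^d} f(y − x) ρ_ε(x) dx. -/

import Mathlib

open Set MeasureTheory

open scoped Nat ContDiff

/-- The `k`-th derivative of a smooth function along the affine line `t ↦ y + t • h`. -/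
lemma ContDiff.iteratedDeriv_comp_add_smul {E V : Type*} [NormedAddCommGroup E]
    [NormedSpace ℝ E] [NormedAddCommGroup V] [NormedSpace ℝ V] {F : E → V} (hF : ContDiff ℝ ∞ F)
    (y h : E) (k : ℕ) (t : ℝ) :
    iteratedDeriv k (fun s : ℝ => F (y + s • h)) t
      = iteratedFDeriv ℝ k F (y + t • h) (fun _ => h) := by
  have hG : ContDiff ℝ k (fun z => F (y + z)) := by
    have : ContDiff ℝ k F := hF.of_le (by exact_mod_cast le_top)
    fun_prop
  have := (ContinuousLinearMap.toSpanSingleton ℝ h).iteratedFDeriv_comp_right hG t le_rfl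
  rw [iteratedDeriv_eq_iteratedFDeriv]
  change iteratedFDeriv ℝ k ((fun z => F (y + z)) ∘ ContinuousLinearMap.toSpanSingleton ℝ h) t _ = _
  rw [this, iteratedFDeriv_comp_add_left]
  simp

namespace SchwartzMap

/-- Taylor's formula for a Schwartz function, with a remainder that decays rapidly in the
base point. -/
lemma exists_taylor_remainder_bound {E V : Type*} [NormedAddCommGroup E]
    [NormedSpace ℝ E] [NormedAddCommGroup V] [NormedSpace ℝ V] (F : SchwartzMap E V) (q m : ℕ) :
    ∃ K : ℝ, 0 ≤ K ∧ ∀ y h : E, (1 + ‖y‖) ^ q *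
      ‖F (y + h) - ∑ k ∈ Finset.range (m + 1),
        ((k ! : ℝ)⁻¹) • iteratedFDeriv ℝ k F y (fun _ => h)‖
        ≤ K * ((1 + ‖h‖) ^ q * ‖h‖ ^ (m + 1)) := by
  obtain ⟨K, hK⟩ : ∃ K : ℝ, ∀ z, (1 + ‖z‖) ^ q * ‖iteratedFDeriv ℝ (m + 1) F z‖ ≤ K :=
    ⟨_, fun z => one_add_le_sup_seminorm_apply (𝕜 := ℝ) (m := (q, m + 1)) le_rfl le_rfl F z⟩
  have hK0 : 0 ≤ K := le_trans (by positivity) (hK 0)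
  refine ⟨K, hK0, fun y h => ?_⟩
  have hF : ContDiff ℝ ∞ F := F.smooth'
  have hg : ContDiff ℝ ∞ (fun s : ℝ => F (y + s • h)) := by fun_prop
  have hu : UniqueDiffOn ℝ (Icc (0 : ℝ) 1) := uniqueDiffOn_Icc one_pos
  have hd (k : ℕ) (t : ℝ) (ht : t ∈ Icc (0 : ℝ) 1) :
      iteratedDerivWithin k (fun s : ℝ => F (y + s • h)) (Icc 0 1) t
        = iteratedFDeriv ℝ k F (y + t • h) (fun _ => h) := by
    rw [iteratedDerivWithin_eq_iteratedDeriv hu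
      ((hg.of_le (by exact_mod_cast le_top)).contDiffAt) ht, hF.iteratedDeriv_comp_add_smul]
  have hy : 0 < (1 + ‖y‖) ^ q := by positivity
  have key := taylor_mean_remainder_bound (f := fun s : ℝ => F (y + s • h)) (n := m)
    (C := K * (1 + ‖h‖) ^ q / (1 + ‖y‖) ^ q * ‖h‖ ^ (m + 1)) zero_le_one
    ((hg.of_le (by exact_mod_cast le_top)).contDiffOn) (right_mem_Icc.2 zero_le_one) (by
      intro t ht
      rw [hd _ t ht]
      refine (ContinuousMultilinearMap.le_opNorm _ _).trans ?_
      simp only [Finset.prod_const, Finset.card_univ, Fintype.card_fin]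
      gcongr
      rw [le_div_iff₀ hy]
      have h1 : 1 + ‖y‖ ≤ (1 + ‖y + t • h‖) * (1 + ‖h‖) := by
        have h2 : ‖y‖ ≤ ‖y + t • h‖ + ‖h‖ := by
          calc ‖y‖ = ‖(y + t • h) - t • h‖ := by simp
            _ ≤ ‖y + t • h‖ + ‖t • h‖ := norm_sub_le _ _
            _ ≤ ‖y + t • h‖ + ‖h‖ := by
              rw [norm_smul, Real.norm_of_nonneg ht.1]
              gcongr
              exact mul_le_of_le_one_left (norm_nonneg _) ht.2
        nlinarith [norm_nonneg (y + t • h), norm_nonneg h]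
      calc _ ≤ ‖iteratedFDeriv ℝ (m + 1) F (y + t • h)‖ *
              ((1 + ‖y + t • h‖) * (1 + ‖h‖)) ^ q := by gcongr
        _ = ((1 + ‖y + t • h‖) ^ q * ‖iteratedFDeriv ℝ (m + 1) F (y + t • h)‖)
              * (1 + ‖h‖) ^ q := by rw [mul_pow]; ring
        _ ≤ _ := by gcongr; exact hK _)
  rw [taylor_within_apply] at key
  have hs : ∑ k ∈ Finset.range (m + 1), (((k ! : ℝ)⁻¹ * (1 - 0) ^ k) •
        iteratedDerivWithin k (fun s : ℝ => F (y + s • h)) (Icc 0 1) 0)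
      = ∑ k ∈ Finset.range (m + 1), ((k ! : ℝ)⁻¹) • iteratedFDeriv ℝ k F y (fun _ => h) := by
    refine Finset.sum_congr rfl fun k _ => ?_
    rw [hd k 0 (left_mem_Icc.2 zero_le_one)]
    simp
  rw [hs] at key
  simp only [one_smul, sub_zero, one_pow, mul_one] at key
  have hfac : (1 : ℝ) ≤ m ! := by exact_mod_cast Nat.one_le_iff_ne_zero.2 (Nat.factorial_ne_zero m)
  calc _ ≤ (1 + ‖y‖) ^ q * (K * (1 + ‖h‖) ^ q / (1 + ‖y‖) ^ q * ‖h‖ ^ (m + 1)) := by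
        gcongr
        exact key.trans (div_le_self (by positivity) hfac)
    _ = _ := by field_simp

section Moments

variable {d : ℕ} {V : Type*} [NormedAddCommGroup V] [NormedSpace ℂ V]
  (ρ : SchwartzMap (EuclideanSpace ℝ (Fin d)) ℂ)

/-- A Schwartz function is integrable against every continuous function of polynomial growth. -/
lemma integrable_smul_of_norm_le_pow {g : EuclideanSpace ℝ (Fin d) → V} (hg : Continuous g)
    {C : ℝ} {k : ℕ} (hC : ∀ x, ‖g x‖ ≤ C * ‖x‖ ^ k) : Integrable (fun x => ρ x • g x) := by
  refine ((ρ.integrable_pow_mul volume k).const_mul C).mono'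
    (ρ.continuous.smul hg).aestronglyMeasurable (Filter.Eventually.of_forall fun x => ?_)
  rw [norm_smul]
  calc _ ≤ ‖ρ x‖ * (C * ‖x‖ ^ k) := by gcongr; exact hC x
    _ = _ := by ring

variable [NormedSpace ℝ V]

lemma integrable_smul_multilinear {k : ℕ}
    (M : ContinuousMultilinearMap ℝ (fun _ : Fin k => EuclideanSpace ℝ (Fin d)) V) :
    Integrable (fun x => ρ x • M (fun _ => x)) := by
  refine ρ.integrable_smul_of_norm_le_pow (C := ‖M‖) (k := k) (by fun_prop) fun x => ?_
  simpa using M.le_opNorm (fun _ => x)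

/-- If all monomial moments of positive degree vanish, then so do the integrals against all
homogeneous polynomial maps of positive degree. -/
lemma integral_smul_multilinear_eq_zero [IsScalarTower ℝ ℂ V] [CompleteSpace V]
    (hρ_mom : ∀ m : Fin d → ℕ, m ≠ 0 →
      (∫ x : EuclideanSpace ℝ (Fin d), (∏ i, (x i : ℂ) ^ m i) * ρ x) = 0)
    {k : ℕ} (hk : k ≠ 0)
    (M : ContinuousMultilinearMap ℝ (fun _ : Fin k => EuclideanSpace ℝ (Fin d)) V) :
    ∫ x, ρ x • M (fun _ => x) = 0 := by
  let e := EuclideanSpace.basisFun (Fin d) ℝ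
  have hM (x : EuclideanSpace ℝ (Fin d)) : ρ x • M (fun _ => x)
      = ∑ r : Fin k → Fin d, ((∏ j, (x (r j) : ℂ)) * ρ x) • M (fun j => e (r j)) := by
    have hx : x = ∑ i, x i • e i := by simpa [e] using (e.sum_repr x).symm
    have h1 : M (fun _ => x) = ∑ r : Fin k → Fin d, (∏ j, x (r j)) • M (fun j => e (r j)) := by
      conv_lhs => rw [hx]
      rw [M.map_sum]
      exact Finset.sum_congr rfl fun r _ => M.map_smul_univ _ _
    rw [h1, Finset.smul_sum]
    refine Finset.sum_congr rfl fun r _ => ?_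
    rw [mul_comm, mul_smul, ← Complex.ofReal_prod, ← Complex.coe_algebraMap, algebraMap_smul]
  simp_rw [hM]
  have hint (r : Fin k → Fin d) : Integrable
      (fun x : EuclideanSpace ℝ (Fin d) => (∏ j, (x (r j) : ℂ)) * ρ x) := by
    have := ρ.integrable_smul_of_norm_le_pow (C := 1) (k := k)
      (g := fun x : EuclideanSpace ℝ (Fin d) => ∏ j, (x (r j) : ℂ)) (by fun_prop) fun x => by
        rw [norm_prod, one_mul]
        calc _ ≤ ∏ _j : Fin k, ‖x‖ := by
              gcongr with j
              rw [Complex.norm_real]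
              exact PiLp.norm_apply_le x (r j)
          _ = _ := by simp
    simpa [mul_comm] using this
  rw [integral_finsetSum _ fun r _ => (hint r).smul_const _]
  refine Finset.sum_eq_zero fun r _ => ?_
  rw [integral_smul_const]
  have hprod (x : EuclideanSpace ℝ (Fin d)) : (∏ j, (x (r j) : ℂ))
      = ∏ i, (x i : ℂ) ^ (Finset.univ.filter fun j => r j = i).card := by
    rw [← Finset.prod_fiberwise_of_maps_to (g := r) (t := Finset.univ) (by simp)]
    refine Finset.prod_congr rfl fun i _ => Finset.prod_eq_pow_card fun j hj => ?_
    rw [(Finset.mem_filter.1 hj).2]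
  simp_rw [hprod]
  rw [hρ_mom, zero_smul]
  intro h0
  have := congrFun h0 (r ⟨0, Nat.pos_of_ne_zero hk⟩)
  simp only [Pi.zero_apply, Finset.card_eq_zero, Finset.filter_eq_empty_iff] at this
  exact this (Finset.mem_univ _) rfl

variable (F : SchwartzMap (EuclideanSpace ℝ (Fin d)) V) (c : ℝ)

lemma integrable_smul_comp_add_smul (z : EuclideanSpace ℝ (Fin d)) :
    Integrable (fun x => ρ x • F (z + c • x)) := by
  refine ρ.integrable_smul_of_norm_le_pow (C := SchwartzMap.seminorm ℝ 0 0 F) (k := 0)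
    (F.continuous.comp (by fun_prop)) fun x => ?_
  simpa using F.norm_le_seminorm ℝ (z + c • x)

lemma hasFDerivAt_integral_smul_comp_add_smul [IsScalarTower ℝ ℂ V]
    (y : EuclideanSpace ℝ (Fin d)) :
    HasFDerivAt (fun z => ∫ x, ρ x • F (z + c • x))
      (∫ x, ρ x • fderivCLM ℝ _ V F (y + c • x)) y := by
  refine hasFDerivAt_integral_of_dominated_of_fderiv_le (s := univ)
    (F' := fun z x => ρ x • fderivCLM ℝ _ V F (z + c • x))
    (bound := fun x => ‖ρ x‖ * SchwartzMap.seminorm ℝ 0 0 (fderivCLM ℝ _ V F)) Filter.univ_mem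
    (Filter.Eventually.of_forall fun z =>
      (ρ.integrable_smul_comp_add_smul F c z).aestronglyMeasurable)
    (ρ.integrable_smul_comp_add_smul F c y)
    (ρ.integrable_smul_comp_add_smul _ c y).aestronglyMeasurable
    (Filter.Eventually.of_forall fun x z _ => ?_)
    (ρ.integrable.norm.mul_const _)
    (Filter.Eventually.of_forall fun x z _ => ?_)
  · rw [norm_smul]
    gcongr
    exact norm_le_seminorm ℝ _ _
  · have h1 : HasFDerivAt (fun z => F (z + c • x)) (fderiv ℝ F (z + c • x)) z :=
      (hasFDerivAt_comp_add_right (c • x)).2 (F.hasFDerivAt (z + c • x))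
    exact h1.const_smul (ρ x)

end Moments

section Approximation

variable {d : ℕ} (ρ : SchwartzMap (EuclideanSpace ℝ (Fin d)) ℂ)

/-- Convolution with a rescaled mollifier approximates a Schwartz function to every order,
with a rapidly decreasing error. -/
lemma exists_approx_bound
    (hρ_int : (∫ x, ρ x) = 1)
    (hρ_mom : ∀ m : Fin d → ℕ, m ≠ 0 →
      (∫ x : EuclideanSpace ℝ (Fin d), (∏ i, (x i : ℂ) ^ m i) * ρ x) = 0)
    {V : Type*} [NormedAddCommGroup V] [NormedSpace ℝ V]
    [NormedSpace ℂ V] [IsScalarTower ℝ ℂ V] [CompleteSpace V]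
    (F : SchwartzMap (EuclideanSpace ℝ (Fin d)) V) (q m : ℕ) :
    ∃ C : ℝ, ∀ c : ℝ, ∀ y, (1 + ‖y‖) ^ q * ‖(∫ x, ρ x • F (y + c • x)) - F y‖
      ≤ C * ((1 + |c|) ^ q * |c| ^ (m + 1)) := by
  obtain ⟨K, hK0, hK⟩ := F.exists_taylor_remainder_bound q m
  have hI : Integrable (fun x : EuclideanSpace ℝ (Fin d) =>
      ‖ρ x‖ * ((1 + ‖x‖) ^ q * ‖x‖ ^ (m + 1))) := by
    have : (fun x : EuclideanSpace ℝ (Fin d) => ‖ρ x‖ * ((1 + ‖x‖) ^ q * ‖x‖ ^ (m + 1)))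
        = fun x => ∑ i ∈ Finset.range (q + 1),
          (q.choose i : ℝ) * (‖x‖ ^ (q - i + (m + 1)) * ‖ρ x‖) := by
      ext x
      rw [add_pow, Finset.sum_mul, Finset.mul_sum]
      refine Finset.sum_congr rfl fun i _ => ?_
      ring
    rw [this]
    exact integrable_finsetSum _ fun i _ => (ρ.integrable_pow_mul volume _).const_mul _
  refine ⟨K * ∫ x, ‖ρ x‖ * ((1 + ‖x‖) ^ q * ‖x‖ ^ (m + 1)), fun c y => ?_⟩
  let D (k : ℕ) := iteratedFDeriv ℝ k F y
  have hD (k : ℕ) (x : EuclideanSpace ℝ (Fin d)) :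
      ρ x • ((k ! : ℝ)⁻¹ • D k (fun _ => c • x))
        = ((k ! : ℝ)⁻¹ * c ^ k) • (ρ x • D k (fun _ => x)) := by
    have : D k (fun _ => c • x) = c ^ k • D k (fun _ => x) := by
      simpa using (D k).map_smul_univ (fun _ => c) (fun _ => x)
    rw [this, smul_smul, smul_comm]
  have hDint (k : ℕ) : Integrable (fun x => ρ x • ((k ! : ℝ)⁻¹ • D k (fun _ => c • x))) := by
    simp_rw [hD]
    exact (ρ.integrable_smul_multilinear (D k)).smul _
  have hsum : ∫ x, ρ x • ∑ k ∈ Finset.range (m + 1), (k ! : ℝ)⁻¹ • D k (fun _ => c • x) = F y := by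
    simp_rw [Finset.smul_sum]
    rw [integral_finsetSum _ fun k _ => hDint k, Finset.sum_range_succ']
    rw [Finset.sum_eq_zero fun k _ => ?_, zero_add]
    · simp [D, integral_smul_const, hρ_int]
    · simp_rw [hD]
      rw [integral_smul, ρ.integral_smul_multilinear_eq_zero hρ_mom k.succ_ne_zero, smul_zero]
  have heq : (∫ x, ρ x • F (y + c • x)) - F y = ∫ x, ρ x • (F (y + c • x) -
      ∑ k ∈ Finset.range (m + 1), (k ! : ℝ)⁻¹ • D k (fun _ => c • x)) := by
    simp_rw [smul_sub]
    rw [integral_sub (ρ.integrable_smul_comp_add_smul F c y), hsum]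
    simp_rw [Finset.smul_sum]
    exact integrable_finsetSum _ fun k _ => hDint k
  have hy : 0 < (1 + ‖y‖) ^ q := by positivity
  rw [heq, mul_comm, ← le_div_iff₀ hy]
  refine (norm_integral_le_of_norm_le
    (hI.const_mul (K * ((1 + |c|) ^ q * |c| ^ (m + 1)) / (1 + ‖y‖) ^ q))
    (Filter.Eventually.of_forall fun x => ?_)).trans_eq ?_
  · rw [norm_smul, div_mul_eq_mul_div, le_div_iff₀ hy]
    have h1 : 1 + |c| * ‖x‖ ≤ (1 + |c|) * (1 + ‖x‖) := by
      nlinarith [abs_nonneg c, norm_nonneg x]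
    calc _ = ‖ρ x‖ * ((1 + ‖y‖) ^ q * ‖F (y + c • x) -
          ∑ k ∈ Finset.range (m + 1), (k ! : ℝ)⁻¹ • D k (fun _ => c • x)‖) := by ring
      _ ≤ ‖ρ x‖ * (K * ((1 + |c| * ‖x‖) ^ q * (|c| * ‖x‖) ^ (m + 1))) := by
        refine mul_le_mul_of_nonneg_left ?_ (norm_nonneg _)
        simpa [norm_smul] using hK y (c • x)
      _ ≤ ‖ρ x‖ * (K * (((1 + |c|) * (1 + ‖x‖)) ^ q * (|c| * ‖x‖) ^ (m + 1))) := by gcongr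
      _ = _ := by rw [mul_pow, mul_pow]; ring
  · rw [integral_const_mul]
    ring

/-- The derivatives of the mollification error are rapidly decreasing to every order in the
scale. -/
lemma exists_iteratedFDeriv_approx_bound
    (hρ_int : (∫ x, ρ x) = 1)
    (hρ_mom : ∀ m : Fin d → ℕ, m ≠ 0 →
      (∫ x : EuclideanSpace ℝ (Fin d), (∏ i, (x i : ℂ) ^ m i) * ρ x) = 0)
    (q m n : ℕ) :
    ∀ {V : Type} [NormedAddCommGroup V] [NormedSpace ℝ V]
    [NormedSpace ℂ V] [IsScalarTower ℝ ℂ V] [CompleteSpace V]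
    (F : SchwartzMap (EuclideanSpace ℝ (Fin d)) V),
    ∃ C : ℝ, ∀ c : ℝ, ∀ y, (1 + ‖y‖) ^ q *
      ‖iteratedFDeriv ℝ n (fun z => (∫ x, ρ x • F (z + c • x)) - F z) y‖
      ≤ C * ((1 + |c|) ^ q * |c| ^ (m + 1)) := by
  induction n with
  | zero =>
    intro V _ _ _ _ _ F
    simpa only [norm_iteratedFDeriv_zero] using ρ.exists_approx_bound hρ_int hρ_mom F q m
  | succ n ih =>
    intro V _ _ _ _ _ F
    obtain ⟨C, hC⟩ := ih (fderivCLM ℝ _ V F)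
    refine ⟨C, fun c y => ?_⟩
    have : fderiv ℝ (fun z => (∫ x, ρ x • F (z + c • x)) - F z)
        = fun z => (∫ x, ρ x • fderivCLM ℝ _ V F (z + c • x)) - fderivCLM ℝ _ V F z :=
      funext fun z =>
        ((ρ.hasFDerivAt_integral_smul_comp_add_smul F c z).sub (F.hasFDerivAt z)).fderiv
    rw [← norm_iteratedFDeriv_fderiv, this]
    exact hC c y

end Approximation

/-- The rescaling `x ↦ ε x` in the convolution with a mollifier. -/
lemma integral_mul_mollifier_eq {d : ℕ} (f ρ : SchwartzMap (EuclideanSpace ℝ (Fin d)) ℂ)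
    {ε : ℝ} (hε : 0 < ε) (z : EuclideanSpace ℝ (Fin d)) :
    ∫ x, f (z - x) * ((((ε ^ d)⁻¹ : ℝ) : ℂ) * ρ (ε⁻¹ • x)) = ∫ x, ρ x • f (z + (-ε) • x) := by
  have h := Measure.integral_comp_inv_smul_of_nonneg volume
    (fun u : EuclideanSpace ℝ (Fin d) => ρ u • f (z + (-ε) • u)) hε.le
  rw [finrank_euclideanSpace_fin] at h
  rw [← inv_smul_smul₀ (pow_ne_zero d hε.ne') (∫ x, ρ x • f (z + (-ε) • x)), ← h,
    ← integral_smul]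
  congr 1 with x
  rw [smul_smul, neg_mul, mul_inv_cancel₀ hε.ne', neg_one_smul, ← sub_eq_add_neg,
    Complex.real_smul, smul_eq_mul]
  ring

end SchwartzMap

/-- If `ρ` is a Schwartz mollifier with `∫ ρ = 1` and all higher moments vanishing, then
for every Schwartz function `f` the net `f ∗ ρ_ε − f` is negligible in the Schwartz sense. -/
theorem stmt6 (d : ℕ) (f ρ : SchwartzMap (EuclideanSpace ℝ (Fin d)) ℂ)
    (hρ_int : (∫ x, ρ x) = 1)
    (hρ_mom : ∀ m : Fin d → ℕ, m ≠ 0 →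
      (∫ x : EuclideanSpace ℝ (Fin d), (∏ i, (x i : ℂ) ^ m i) * ρ x) = 0) :
    ∀ q l m : ℕ, ∃ C > (0:ℝ), ∃ ε₀ ∈ Ioc (0:ℝ) 1, ∀ ε ∈ Ioo (0:ℝ) ε₀, ∀ y, ∀ n ≤ l,
      (1 + ‖y‖) ^ q *
        ‖iteratedFDeriv ℝ n
          (fun z => (∫ x, f (z - x) * ((((ε ^ d)⁻¹ : ℝ) : ℂ) * ρ (ε⁻¹ • x))) - f z) y‖
        ≤ C * ε ^ (m : ℝ) := by
  intro q l m
  choose C hC using fun n => ρ.exists_iteratedFDeriv_approx_bound hρ_int hρ_mom q m n f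
  have hS : 0 ≤ ∑ n ∈ Finset.range (l + 1), |C n| := by positivity
  refine ⟨(∑ n ∈ Finset.range (l + 1), |C n|) * 2 ^ q + 1, by positivity, 1, by simp,
    fun ε hε y n hn => ?_⟩
  have hn' : C n ≤ ∑ n ∈ Finset.range (l + 1), |C n| :=
    (le_abs_self _).trans (Finset.single_le_sum (f := fun n => |C n|)
      (fun _ _ => abs_nonneg _) (Finset.mem_range.2 (Nat.lt_succ_of_le hn)))
  obtain ⟨hε0, hε1⟩ := hε
  simp_rw [f.integral_mul_mollifier_eq ρ hε0]
  refine (hC n (-ε) y).trans ?_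
  rw [abs_neg, abs_of_pos hε0, Real.rpow_natCast]
  calc _ ≤ (∑ n ∈ Finset.range (l + 1), |C n|) * (2 ^ q * ε ^ m) := by
        gcongr ?_ * (?_ ^ q * ?_)
        · linarith
        · exact pow_le_pow_of_le_one hε0.le hε1.le m.le_succ
    _ ≤ _ := by
      rw [add_mul, ← mul_assoc]
      linarith [pow_pos hε0 m]
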